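/- Let U be an n × n real orthogonal matrix (UᵀU = I), and let Φ be the ℝ-linear map sending a filter tuple p : Fin n → Polynomial ℝ to the matrix Uᵀ · Δ(p) · U with entries in the multivariate polynomial ring MvPolynomial (Fin n) ℝ, where Δ(p) is the diagonal matrix whose (i, i) entry is the polynomial p i evaluated at the i-th variable X_i, and the entries of U are included into the polynomial ring as constants. Then the adapted graph families 𝔾 := Φ(ℍ) and 𝔾' := Φ(ℍ') are ℝ-subspaces of the matrix space with 𝔾 strictly contained in 𝔾', dim 𝔾 = K + 1 and dim 𝔾' = K + 2K' + 3, so that dim 𝔾' / dim 𝔾 = (K + 2K' + 3) / (K + 1). -/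

import Mathlib

open Matrix

/-- `v k`: the constant tuple all of whose entries equal the monomial `X^k`. -/
noncomputable def vTuple (n K : ℕ) : Fin (K + 1) → (Fin n → Polynomial ℝ) :=
  fun k _ => Polynomial.X ^ (k : ℕ)

/-- `w j`: first `t` entries equal `X^j`, remaining entries are `0`. -/
noncomputable def wTuple (n K' t : ℕ) : Fin (K' + 1) → (Fin n → Polynomial ℝ) :=
  fun j i => if (i : ℕ) < t then Polynomial.X ^ (j : ℕ) else 0

/-- `u j`: last `t` entries equal `X^j`, remaining entries are `0`. -/
noncomputable def uTuple (n K' t : ℕ) : Fin (K' + 1) → (Fin n → Polynomial ℝ) :=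
  fun j i => if n - t ≤ (i : ℕ) then Polynomial.X ^ (j : ℕ) else 0

/-- Distinct powers of `X` are linearly independent over any semiring. -/
theorem Polynomial.linearIndependent_X_pow_fin (R : Type*) [Semiring R] (m : ℕ) :
    LinearIndependent R (fun k : Fin m => (Polynomial.X : Polynomial R) ^ (k : ℕ)) := by
  have h := (Polynomial.basisMonomials R).linearIndependent.comp _ (Fin.val_injective (n := m))
  simpa [Function.comp_def, Polynomial.monomial_one_right_eq_X_pow] using h

theorem linearIndependent_vTuple {n K : ℕ} (hn : 0 < n) :
    LinearIndependent ℝ (vTuple n K) :=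
  LinearIndependent.of_comp (LinearMap.proj (⟨0, hn⟩ : Fin n))
    (Polynomial.linearIndependent_X_pow_fin ℝ (K + 1))

theorem linearIndependent_sumElim_tuples {n K K' t : ℕ} (ht : 1 ≤ t) (htn : 2 * t < n) :
    LinearIndependent ℝ (Sum.elim (Sum.elim (vTuple n K) (wTuple n K' t)) (uTuple n K' t)) := by
  rw [Fintype.linearIndependent_iff]
  intro g hg
  have hpow (m : ℕ) := Fintype.linearIndependent_iff.mp (Polynomial.linearIndependent_X_pow_fin ℝ m)
  simp only [Fintype.sum_sum_type, Sum.elim_inl, Sum.elim_inr] at hg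
  have entry (i : Fin n) := congrFun hg i
  simp only [Pi.add_apply, Finset.sum_apply, Pi.smul_apply, Pi.zero_apply, vTuple, wTuple,
    uTuple] at entry
  have hv := hpow (K + 1) (fun k => g (.inl (.inl k))) (by
    simpa [show ¬ n - t ≤ t by omega] using entry ⟨t, by omega⟩)
  have hw := hpow (K' + 1) (fun k => g (.inl (.inr k))) (by
    simpa [hv, show 0 < t by omega, show n - t ≠ 0 by omega] using entry ⟨0, by omega⟩)
  have hu := hpow (K' + 1) (fun k => g (.inr k)) (by
    simpa [hv, hw, show n - t ≤ n - 1 by omega, -tsub_le_iff_right]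
      using entry ⟨n - 1, by omega⟩)
  rintro ((k | k) | k)
  exacts [hv k, hw k, hu k]

/-- Conjugating diagonal matrices of univariate polynomials in separate variables by an
orthogonal matrix is injective. -/
theorem conj_diagonal_aeval_injective {ι R : Type*} [Fintype ι] [DecidableEq ι] [CommRing R]
    {U : Matrix ι ι R} (hU : Uᵀ * U = 1) :
    Function.Injective fun p : ι → Polynomial R =>
      (U.map (MvPolynomial.C (σ := ι)))ᵀ
        * Matrix.diagonal (fun i => Polynomial.aeval (MvPolynomial.X i) (p i))
        * U.map MvPolynomial.C := by
  have hV : U.map (MvPolynomial.C (σ := ι)) * (U.map (MvPolynomial.C (σ := ι)))ᵀ = 1 := by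
    rw [← Matrix.transpose_map, ← Matrix.map_mul, mul_eq_one_comm.mp hU]
    exact Matrix.map_one _ (map_zero _) (map_one _)
  intro p q hpq
  have hconj (D : Matrix ι ι (MvPolynomial ι R)) :
      U.map MvPolynomial.C * ((U.map MvPolynomial.C)ᵀ * D * U.map MvPolynomial.C)
        * (U.map MvPolynomial.C)ᵀ = D := by
    rw [Matrix.mul_assoc (_ᵀ), ← Matrix.mul_assoc, hV, Matrix.one_mul, Matrix.mul_assoc, hV,
      Matrix.mul_one]
  have hdiag := congrArg
    (fun M => U.map MvPolynomial.C * M * (U.map (MvPolynomial.C (σ := ι)))ᵀ) hpq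
  simp only [hconj] at hdiag
  funext i
  exact transcendental_iff_injective.mp (MvPolynomial.transcendental_X R i)
    (congrFun (Matrix.diagonal_injective hdiag) i)

/-- for an orthogonal `U` and the linear map
`Φ(p) = Uᵀ · Δ(p) · U` (with `Δ(p)` the diagonal matrix whose `(i,i)` entry is `p i`
evaluated at the `i`-th variable, and the entries of `U` viewed as constants in the
multivariate polynomial ring), the adapted graph families `𝔾 = Φ(ℍ)` and
`𝔾' = Φ(ℍ')` satisfy `𝔾 ⊂ 𝔾'` strictly, `dim 𝔾 = K + 1`, `dim 𝔾' = K + 2K' + 3`,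
and hence `dim 𝔾' / dim 𝔾 = (K + 2K' + 3)/(K + 1)`. -/
theorem adapted_graph_space_dimensions (n K K' t : ℕ) (hK' : K' ≤ K) (ht : 1 ≤ t)
    (htn : 2 * t < n)
    (U : Matrix (Fin n) (Fin n) ℝ) (hU : Uᵀ * U = 1)
    (Φ : (Fin n → Polynomial ℝ) →ₗ[ℝ] Matrix (Fin n) (Fin n) (MvPolynomial (Fin n) ℝ))
    (hΦ : ∀ p : Fin n → Polynomial ℝ,
      Φ p = (U.map (MvPolynomial.C))ᵀ
              * Matrix.diagonal (fun i => Polynomial.aeval (MvPolynomial.X i) (p i))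
              * U.map (MvPolynomial.C)) :
    Submodule.map Φ (Submodule.span ℝ (Set.range (vTuple n K)))
        < Submodule.map Φ (Submodule.span ℝ
            (Set.range (vTuple n K) ∪ Set.range (wTuple n K' t)
              ∪ Set.range (uTuple n K' t)))
      ∧ Module.finrank ℝ
          ↥(Submodule.map Φ (Submodule.span ℝ (Set.range (vTuple n K)))) = K + 1
      ∧ Module.finrank ℝ
          ↥(Submodule.map Φ (Submodule.span ℝ
              (Set.range (vTuple n K) ∪ Set.range (wTuple n K' t)
                ∪ Set.range (uTuple n K' t)))) = K + 2 * K' + 3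
      ∧ ((Module.finrank ℝ
            ↥(Submodule.map Φ (Submodule.span ℝ
                (Set.range (vTuple n K) ∪ Set.range (wTuple n K' t)
                  ∪ Set.range (uTuple n K' t)))) : ℚ)
          / (Module.finrank ℝ
              ↥(Submodule.map Φ (Submodule.span ℝ (Set.range (vTuple n K)))) : ℚ)
        = ((K : ℚ) + 2 * K' + 3) / ((K : ℚ) + 1)) := by
  have hker : LinearMap.ker Φ = ⊥ := LinearMap.ker_eq_bot.mpr <| by
    rw [show (Φ : _ → _) = _ from funext hΦ]
    exact conj_diagonal_aeval_injective hU
  have hdim : Module.finrank ℝ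
      ↥(Submodule.map Φ (Submodule.span ℝ (Set.range (vTuple n K)))) = K + 1 := by
    rw [Submodule.map_span, ← Set.range_comp,
      finrank_span_eq_card ((linearIndependent_vTuple (by omega)).map' Φ hker), Fintype.card_fin]
  have hdim' : Module.finrank ℝ
      ↥(Submodule.map Φ (Submodule.span ℝ
        (Set.range (vTuple n K) ∪ Set.range (wTuple n K' t)
          ∪ Set.range (uTuple n K' t)))) = K + 2 * K' + 3 := by
    rw [← Set.Sum.elim_range, ← Set.Sum.elim_range, Submodule.map_span, ← Set.range_comp,
      finrank_span_eq_card ((linearIndependent_sumElim_tuples ht htn).map' Φ hker)]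
    simp only [Fintype.card_sum, Fintype.card_fin]
    omega
  refine ⟨lt_of_le_of_ne ?_ fun h => ?_, hdim, hdim', ?_⟩
  · exact Submodule.map_mono <| Submodule.span_mono <|
      Set.subset_union_left.trans Set.subset_union_left
  · rw [h, hdim'] at hdim
    omega
  · rw [hdim, hdim']
    push_cast
    rfl
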